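/- Let S and A be nonempty finite types, T : ℕ a horizon, and γ ∈ (0,1). Let μ₀ : S → ℝ be a probability mass function on S (nonnegative, summing to 1), let p, q : S → A → S → ℝ be transition kernels (for every (s,a), the functions p s a and q s a are nonnegative and sum to 1 over S), let π, π_c : S → A → ℝ be policies (for every s, the functions π s and π_c s are nonnegative and sum to 1 over A), and assume all of μ₀, p, q, π, π_c are strictly positive everywhere. Let r : S → A → ℝ satisfy r s a ≥ 1 for all (s,a). A trajectory is a pair τ = (σ, α) with σ : Fin (T+2) → S and α : Fin (T+1) → A. Define P τ = μ₀(σ 0) · ∏_{t=0}^{T} p (σ t) (α t) (σ (t+1)) · π (σ t) (α t), Q τ = μ₀(σ 0) · ∏_{t=0}^{T} q (σ t) (α t) (σ (t+1)) · π_c (σ t) (α t), the return R τ = ∑_{t=0}^{T} γ^t · r (σ t) (α t), and the shifts-aware reward r̃(t, τ) = log(r (σ t) (α t)) + (1/((1−γ)·γ^t))·(log(p (σ t) (α t) (σ (t+1)) / q (σ t) (α t) (σ (t+1))) + log(π (σ t) (α t) / π_c (σ t) (α t))). Then log(∑_τ P τ · R τ) ≥ (1−γ) · ∑_τ Q τ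 · (∑_{t=0}^{T} γ^t · r̃(t, τ)), where the sums over τ range over all trajectories. -/

import Mathlib

/-- The path probabilities of a controlled Markov chain started at `s` sum to one. -/
theorem sum_prod_kernel_cons_eq_one {S A : Type*} [Fintype S] [Fintype A]
    (k : S → A → S → ℝ) (hk : ∀ s, ∑ s', ∑ a, k s a s' = 1) (n : ℕ) (s : S) :
    ∑ σ : Fin n → S, ∑ α : Fin n → A,
      ∏ t : Fin n, k ((Fin.cons s σ : Fin (n + 1) → S) t.castSucc) (α t) (σ t) = 1 := by
  induction n generalizing s with
  | zero => simp
  | succ n ih =>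
    rw [← (Fin.consEquiv fun _ => S).sum_comp, Fintype.sum_prod_type, ← hk s]
    refine Finset.sum_congr rfl fun s' _ => ?_
    simp_rw [← (Fin.consEquiv fun _ => A).sum_comp, Fintype.sum_prod_type]
    rw [Finset.sum_comm]
    refine Finset.sum_congr rfl fun a _ => ?_
    simp only [Fin.consEquiv_apply, Fin.prod_univ_succ, Fin.castSucc_zero, Fin.cons_zero,
      Fin.cons_succ, ← Fin.succ_castSucc, ← Finset.mul_sum, ih s', mul_one]

/-- Trajectory probabilities of a controlled Markov chain sum to one. -/
theorem sum_trajectory_prob_eq_one {S A : Type*} [Fintype S] [Fintype A]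
    (μ : S → ℝ) (hμ : ∑ s, μ s = 1)
    (k : S → A → S → ℝ) (hk : ∀ s, ∑ s', ∑ a, k s a s' = 1) (n : ℕ) :
    ∑ τ : (Fin (n + 1) → S) × (Fin n → A),
      μ (τ.1 0) * ∏ t : Fin n, k (τ.1 t.castSucc) (τ.2 t) (τ.1 t.succ) = 1 := by
  rw [Fintype.sum_prod_type, ← (Fin.consEquiv fun _ => S).sum_comp, Fintype.sum_prod_type, ← hμ]
  refine Finset.sum_congr rfl fun s _ => ?_
  simp only [Fin.consEquiv_apply, Fin.cons_zero, Fin.cons_succ, ← Finset.mul_sum,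
    sum_prod_kernel_cons_eq_one k hk n s, mul_one]

/-- The weighted tangent-line bound for the logarithm at `z`. -/
theorem sum_mul_log_le {ι : Type*} [Fintype ι] (w x : ι → ℝ) (hw : ∀ i, 0 ≤ w i)
    (hx : ∀ i, 0 < x i) {z : ℝ} (hz : 0 < z) :
    ∑ i, w i * Real.log (x i) ≤
      (∑ i, w i) * Real.log z + (∑ i, w i * x i) / z - ∑ i, w i := by
  rw [Finset.sum_mul, Finset.sum_div, ← Finset.sum_add_distrib, ← Finset.sum_sub_distrib]
  refine Finset.sum_le_sum fun i _ => ?_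
  have h := Real.log_le_sub_one_of_pos (div_pos (hx i) hz)
  rw [Real.log_div (hx i).ne' hz.ne'] at h
  calc w i * Real.log (x i) ≤ w i * (Real.log z + x i / z - 1) :=
        mul_le_mul_of_nonneg_left (by linarith) (hw i)
    _ = _ := by ring

/-- Jensen's inequality for the logarithm under truncated geometric weights,
for values that are at least one. -/
theorem geometric_sum_log_le_log_sum {γ : ℝ} (hγ0 : 0 < γ) (hγ1 : γ < 1) (n : ℕ)
    (x : Fin (n + 1) → ℝ) (hx : ∀ t, 1 ≤ x t) :
    (1 - γ) * ∑ t : Fin (n + 1), γ ^ (t : ℕ) * Real.log (x t) ≤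
      Real.log (∑ t : Fin (n + 1), γ ^ (t : ℕ) * x t) := by
  have hx0 : ∀ t, 0 < x t := fun t => one_pos.trans_le (hx t)
  set z := ∑ t : Fin (n + 1), γ ^ (t : ℕ) * x t with hz
  have hz1 : 1 ≤ z := by
    rw [hz, Fin.sum_univ_succ]
    have : 0 ≤ ∑ t : Fin n, γ ^ (t.succ : ℕ) * x t.succ :=
      Finset.sum_nonneg fun t _ => mul_nonneg (by positivity) (hx0 _).le
    rw [Fin.val_zero, pow_zero, one_mul]
    linarith [hx 0]
  have hsum : (1 - γ) * ∑ t : Fin (n + 1), γ ^ (t : ℕ) = 1 - γ ^ (n + 1) := by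
    rw [Fin.sum_univ_eq_sum_range (fun i => γ ^ i), mul_neg_geom_sum]
  have h := sum_mul_log_le (fun t : Fin (n + 1) => γ ^ (t : ℕ)) x
    (fun t => by positivity) hx0 (one_pos.trans_le hz1)
  rw [← hz, div_self (by positivity)] at h
  have h' := mul_le_mul_of_nonneg_left h (sub_nonneg.2 hγ1.le)
  have hlog := Real.log_nonneg hz1
  have hpow : γ ^ (n + 1) ≤ γ := pow_le_of_le_one hγ0.le hγ1.le n.succ_ne_zero
  have hpow0 : 0 ≤ γ ^ (n + 1) * Real.log z := by positivity
  linear_combination h' + (Real.log z - 1) * hsum + hpow + hpow0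

/-- The evidence lower bound: the log of a sum dominates the `q`-average of log ratios. -/
theorem sum_mul_log_div_le_log_sum {ι : Type*} [Fintype ι] (q f : ι → ℝ)
    (hq : ∀ i, 0 < q i) (hq1 : ∑ i, q i = 1) (hf : ∀ i, 0 < f i) :
    ∑ i, q i * Real.log (f i / q i) ≤ Real.log (∑ i, f i) := by
  have hne : (Finset.univ : Finset ι).Nonempty :=
    Finset.nonempty_of_sum_ne_zero (hq1.trans_ne one_ne_zero)
  have hz : 0 < ∑ i, f i := Finset.sum_pos (fun i _ => hf i) hne
  have h := sum_mul_log_le q (fun i => f i / q i) (fun i => (hq i).le)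
    (fun i => div_pos (hf i) (hq i)) hz
  simp_rw [mul_div_cancel₀ _ (hq _).ne'] at h
  rw [hq1, div_self hz.ne'] at h
  linarith


/-- Finite-horizon, finite state-action instantiation of Theorem 1 (SAMBO-RL). -/
theorem sambo_theorem1_finite
    {S A : Type*} [Fintype S] [Fintype A] [Nonempty S] [Nonempty A]
    (T : ℕ) (γ : ℝ) (hγ0 : 0 < γ) (hγ1 : γ < 1)
    (μ₀ : S → ℝ) (hμ0 : ∀ s, 0 ≤ μ₀ s) (hμ1 : ∑ s, μ₀ s = 1)
    (hμpos : ∀ s, 0 < μ₀ s)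
    (p q : S → A → S → ℝ)
    (hp0 : ∀ s a s', 0 ≤ p s a s') (hp1 : ∀ s a, ∑ s', p s a s' = 1)
    (hq0 : ∀ s a s', 0 ≤ q s a s') (hq1 : ∀ s a, ∑ s', q s a s' = 1)
    (hppos : ∀ s a s', 0 < p s a s') (hqpos : ∀ s a s', 0 < q s a s')
    (π πc : S → A → ℝ)
    (hπ0 : ∀ s a, 0 ≤ π s a) (hπ1 : ∀ s, ∑ a, π s a = 1)
    (hπc0 : ∀ s a, 0 ≤ πc s a) (hπc1 : ∀ s, ∑ a, πc s a = 1)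
    (hπpos : ∀ s a, 0 < π s a) (hπcpos : ∀ s a, 0 < πc s a)
    (r : S → A → ℝ) (hr : ∀ s a, 1 ≤ r s a)
    (P Q R : ((Fin (T + 2) → S) × (Fin (T + 1) → A)) → ℝ)
    (rt : Fin (T + 1) → ((Fin (T + 2) → S) × (Fin (T + 1) → A)) → ℝ)
    (hP : ∀ τ, P τ = μ₀ (τ.1 0) * ∏ t : Fin (T + 1),
      p (τ.1 t.castSucc) (τ.2 t) (τ.1 t.succ) * π (τ.1 t.castSucc) (τ.2 t))
    (hQ : ∀ τ, Q τ = μ₀ (τ.1 0) * ∏ t : Fin (T + 1),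
      q (τ.1 t.castSucc) (τ.2 t) (τ.1 t.succ) * πc (τ.1 t.castSucc) (τ.2 t))
    (hR : ∀ τ, R τ = ∑ t : Fin (T + 1), γ ^ (t : ℕ) * r (τ.1 t.castSucc) (τ.2 t))
    (hrt : ∀ (t : Fin (T + 1)) τ, rt t τ =
      Real.log (r (τ.1 t.castSucc) (τ.2 t)) +
        (1 / ((1 - γ) * γ ^ (t : ℕ))) *
          (Real.log (p (τ.1 t.castSucc) (τ.2 t) (τ.1 t.succ) /
              q (τ.1 t.castSucc) (τ.2 t) (τ.1 t.succ)) +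
            Real.log (π (τ.1 t.castSucc) (τ.2 t) / πc (τ.1 t.castSucc) (τ.2 t)))) :
    Real.log (∑ τ : (Fin (T + 2) → S) × (Fin (T + 1) → A), P τ * R τ) ≥
      (1 - γ) * ∑ τ : (Fin (T + 2) → S) × (Fin (T + 1) → A),
        Q τ * ∑ t : Fin (T + 1), γ ^ (t : ℕ) * rt t τ := by
  have hk : ∀ s, ∑ s', ∑ a, q s a s' * πc s a = 1 := fun s => by
    rw [Finset.sum_comm]
    simp_rw [← Finset.sum_mul, hq1, one_mul, hπc1]
  have hQ1 : ∑ τ, Q τ = 1 := by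
    simp_rw [hQ]
    exact sum_trajectory_prob_eq_one μ₀ hμ1 (fun s a s' => q s a s' * πc s a) hk (T + 1)
  have hPpos : ∀ τ, 0 < P τ := fun τ => by
    rw [hP]
    exact mul_pos (hμpos _) (Finset.prod_pos fun t _ => mul_pos (hppos _ _ _) (hπpos _ _))
  have hQpos : ∀ τ, 0 < Q τ := fun τ => by
    rw [hQ]
    exact mul_pos (hμpos _) (Finset.prod_pos fun t _ => mul_pos (hqpos _ _ _) (hπcpos _ _))
  have hRpos : ∀ τ, 0 < R τ := fun τ => by
    rw [hR]
    exact Finset.sum_pos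
      (fun t _ => mul_pos (pow_pos hγ0 _) (one_pos.trans_le (hr _ _))) Finset.univ_nonempty
  have hγ : 1 - γ ≠ 0 := (sub_pos.2 hγ1).ne'
  have hratio : ∀ τ, Real.log (P τ / Q τ) = ∑ t : Fin (T + 1),
      (Real.log (p (τ.1 t.castSucc) (τ.2 t) (τ.1 t.succ) /
          q (τ.1 t.castSucc) (τ.2 t) (τ.1 t.succ)) +
        Real.log (π (τ.1 t.castSucc) (τ.2 t) / πc (τ.1 t.castSucc) (τ.2 t))) := fun τ => by
    rw [hP, hQ, mul_div_mul_left _ _ (hμpos _).ne', ← Finset.prod_div_distrib, Real.log_prod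
      fun t _ => (div_pos (mul_pos (hppos _ _ _) (hπpos _ _))
        (mul_pos (hqpos _ _ _) (hπcpos _ _))).ne']
    refine Finset.sum_congr rfl fun t _ => ?_
    rw [mul_div_mul_comm, Real.log_mul (div_pos (hppos _ _ _) (hqpos _ _ _)).ne'
      (div_pos (hπpos _ _) (hπcpos _ _)).ne']
  have hpath : ∀ τ, (1 - γ) * ∑ t : Fin (T + 1), γ ^ (t : ℕ) * rt t τ ≤
      Real.log (P τ * R τ / Q τ) := fun τ => by
    have hreward := geometric_sum_log_le_log_sum hγ0 hγ1 T
      (fun t => r (τ.1 t.castSucc) (τ.2 t)) (fun t => hr _ _)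
    rw [← hR] at hreward
    rw [mul_div_right_comm, Real.log_mul (div_pos (hPpos τ) (hQpos τ)).ne' (hRpos τ).ne', hratio]
    refine le_trans (le_of_eq ?_) (add_le_add_right hreward _)
    rw [Finset.mul_sum, Finset.mul_sum, ← Finset.sum_add_distrib]
    refine Finset.sum_congr rfl fun t _ => ?_
    have hγt : γ ^ (t : ℕ) ≠ 0 := (pow_pos hγ0 _).ne'
    rw [hrt]
    field_simp
    ring
  refine le_trans ?_ (sum_mul_log_div_le_log_sum Q (fun τ => P τ * R τ) hQpos hQ1
    fun τ => mul_pos (hPpos τ) (hRpos τ))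
  rw [Finset.mul_sum]
  refine Finset.sum_le_sum fun τ _ => ?_
  rw [mul_left_comm]
  exact mul_le_mul_of_nonneg_left (hpath τ) (hQpos τ).le
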